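/- Let B be an instance of (2,2)-E3-SAT and let J be the TAP instance constructed from B as described. If B admits a satisfying truth assignment, then J admits a stable matching. -/

import Mathlib

structure TAP (A : Type*) (S : Type*) (P : Type*) where
  ptype : A → Finset P
  prefA : A → List S
  cap : S → P → ℕ
  prefS : S → List A

namespace TAP

variable {A S P : Type*} [DecidableEq A] [DecidableEq S] [DecidableEq P] (J : TAP A S P)

def WellFormed : Prop :=
  (∀ a, (J.ptype a).card = 2) ∧ (∀ a, (J.prefA a).Nodup) ∧
  (∀ s, (J.prefS s).Nodup) ∧ (∀ a s, a ∈ J.prefS s ↔ s ∈ J.prefA a)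

def IsAssignment (M : Finset (A × S)) : Prop :=
  (∀ x ∈ M, x.2 ∈ J.prefA x.1) ∧
  ∀ a s s', (a, s) ∈ M → (a, s') ∈ M → s = s'

def Mp (M : Finset (A × S)) (s : S) (p : P) : Finset A :=
  (M.filter (fun x => x.2 = s ∧ p ∈ J.ptype x.1)).image Prod.fst

def Mpr (M : Finset (A × S)) (s : S) (p r : P) : Finset A :=
  (M.filter (fun x => x.2 = s ∧ J.ptype x.1 = {p, r})).image Prod.fst

def IsMatching (M : Finset (A × S)) : Prop :=
  J.IsAssignment M ∧ ∀ s p, (J.Mp M s p).card ≤ J.cap s p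

def Undersub (M : Finset (A × S)) (s : S) (p : P) : Prop :=
  (J.Mp M s p).card < J.cap s p

def PrefersA (a : A) (s s' : S) : Prop :=
  s ∈ J.prefA a ∧ s' ∈ J.prefA a ∧ (J.prefA a).idxOf s < (J.prefA a).idxOf s'

def PrefersS (s : S) (a a' : A) : Prop :=
  a ∈ J.prefS s ∧ a' ∈ J.prefS s ∧ (J.prefS s).idxOf a < (J.prefS s).idxOf a'

def Unassigned (M : Finset (A × S)) (a : A) : Prop := ∀ s, (a, s) ∉ M

def Blocks (M : Finset (A × S)) (a : A) (s : S) : Prop :=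
  s ∈ J.prefA a ∧
  (Unassigned M a ∨ ∃ s', (a, s') ∈ M ∧ J.PrefersA a s s') ∧
  ∃ p₁ p₂, p₁ ≠ p₂ ∧ J.ptype a = {p₁, p₂} ∧
    ((J.Undersub M s p₁ ∧ J.Undersub M s p₂) ∨
     (J.Undersub M s p₁ ∧ ∃ b ∈ J.Mp M s p₂, J.PrefersS s a b) ∨
     (J.Undersub M s p₂ ∧ ∃ b ∈ J.Mp M s p₁, J.PrefersS s a b) ∨
     (∃ b ∈ J.Mpr M s p₁ p₂, J.PrefersS s a b) ∨
     (∃ b₁ ∈ J.Mp M s p₁, ∃ b₂ ∈ J.Mp M s p₂, b₁ ≠ b₂ ∧ J.PrefersS s a b₁ ∧ J.PrefersS s a b₂))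

def Stable (M : Finset (A × S)) : Prop :=
  J.IsMatching M ∧ ∀ a s, ¬ J.Blocks M a s

end TAP
/-- The three subjects. -/
inductive Subj : Type where
  | F | I | M
deriving DecidableEq

/-- An instance of (2,2)-E3-SAT with variables `Fin n` and clauses `Fin m`:
`clause j t` is the literal (variable, polarity) in position `t` of clause `j`;
`occurs v b o` is the (clause, position) of the `o`-th occurrence of the literal
`(v, b)`, and `occInv` is its two-sided inverse, so that each clause has exactly
3 literals and each literal occurs exactly twice. -/
structure E3SAT (n m : ℕ) where
  clause : Fin m → Fin 3 → Fin n × Bool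
  occurs : Fin n → Bool → Fin 2 → Fin m × Fin 3
  occInv : Fin m → Fin 3 → Fin n × Bool × Fin 2
  clause_occurs : ∀ v b o, clause (occurs v b o).1 (occurs v b o).2 = (v, b)
  occurs_occInv : ∀ j t, occurs (occInv j t).1 (occInv j t).2.1 (occInv j t).2.2 = (j, t)
  occInv_occurs : ∀ v b o, occInv (occurs v b o).1 (occurs v b o).2 = (v, b, o)

/-- `f` is a satisfying truth assignment of `B`. -/
def E3SAT.Satisfies {n m : ℕ} (B : E3SAT n m) (f : Fin n → Bool) : Prop :=
  ∀ j : Fin m, ∃ t : Fin 3, f (B.clause j t).1 = (B.clause j t).2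
/-- The applicants of the TAP instance constructed from a (2,2)-E3-SAT instance.
Indices are 0-based: `a i r` is the applicant `a_{i+1}^{r+1}` of the paper,
`x i r` is `x_{i+1}^{r+1}`, `y i r` is `y_{i+1}^{r+1}` and `q i t k` is
`q_{i+1,t+1}^{k+1}`. -/
inductive TApp (n m : ℕ) : Type where
  | a (i : Fin n) (r : Fin 6)
  | x (i : Fin n) (r : Fin 2)
  | y (i : Fin n) (r : Fin 2)
  | q (i : Fin n) (t : Fin 3) (k : Fin 4)
deriving DecidableEq

/-- The schools of the TAP instance constructed from a (2,2)-E3-SAT instance.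
`s i r` is the school `s_{i+1}^{r+1}` of the paper, `w i t k` is `w_{i+1,t+1}^{k+1}`
and `z j` is `z_{j+1}`. -/
inductive TSch (n m : ℕ) : Type where
  | s (i : Fin n) (r : Fin 4)
  | sT (i : Fin n)
  | sF (i : Fin n)
  | w (i : Fin n) (t : Fin 3) (k : Fin 4)
  | z (j : Fin m)
deriving DecidableEq

namespace TApp

variable {n m : ℕ}

/-- The applicant `A(w_{i,3}^k)`: `x_i^k` for `k ∈ {1,2}` and `y_i^{k-2}` for `k ∈ {3,4}`. -/
def Aw (i : Fin n) (k : Fin 4) : TApp n m :=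
  if h : k.1 < 2 then .x i ⟨k.1, h⟩ else .y i ⟨k.1 - 2, by have := k.2; omega⟩

/-- The x- or y-applicant corresponding to the literal occurrence in position `t`
of clause `j`. -/
def litApp (B : E3SAT n m) (j : Fin m) (t : Fin 3) : TApp n m :=
  if (B.occInv j t).2.1 then .x (B.occInv j t).1 (B.occInv j t).2.2
  else .y (B.occInv j t).1 (B.occInv j t).2.2

end TApp

open Subj in
/-- The TAP instance `J` constructed from the (2,2)-E3-SAT instance `B`. -/
def tapOf {n m : ℕ} (B : E3SAT n m) : TAP (TApp n m) (TSch n m) Subj where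
  ptype
    | .a _ r => if r = 2 then {F, M} else if r = 3 then {I, M} else {F, I}
    | .x _ r => if r = 0 then {F, M} else {I, M}
    | .y _ r => if r = 0 then {F, M} else {I, M}
    | .q _ t _ => if t = 0 then {F, M} else if t = 1 then {I, M} else {F, I}
  prefA
    | .a i r =>
        if r = 0 then [.s i 0, .s i 2]
        else if r = 1 then [.s i 1, .s i 3]
        else if r = 2 then [.s i 0, .s i 1]
        else if r = 3 then [.s i 1, .s i 0]
        else if r = 4 then [.s i 2, .sT i]
        else [.s i 3, .sF i]
    | .x i r => [.sT i, .z (B.occurs i true r).1, .w i 2 ⟨r.1, by have := r.2; omega⟩]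
    | .y i r => [.sF i, .z (B.occurs i false r).1, .w i 2 ⟨r.1 + 2, by have := r.2; omega⟩]
    | .q i t k =>
        if t = 0 then [.w i 1 k, .w i 0 k]
        else if t = 1 then [.w i 0 k, .w i 1 k]
        else [.w i 2 k, .w i 0 k]
  cap
    | .s _ r, p => if p = M then (if r = 0 ∨ r = 1 then 2 else 0) else 1
    | .sT _, p => if p = M then 2 else 1
    | .sF _, p => if p = M then 2 else 1
    | .w _ t _, p => if p = M then (if t = 2 then 1 else 2) else 1
    | .z _, _ => 2
  prefS
    | .s i r =>
        if r = 0 then [.a i 3, .a i 0, .a i 2]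
        else if r = 1 then [.a i 2, .a i 1, .a i 3]
        else if r = 2 then [.a i 0, .a i 4]
        else [.a i 1, .a i 5]
    | .sT i => [.a i 4, .x i 0, .x i 1]
    | .sF i => [.a i 5, .y i 0, .y i 1]
    | .w i t k =>
        if t = 0 then [.q i 0 k, .q i 2 k, .q i 1 k]
        else if t = 1 then [.q i 1 k, .q i 0 k]
        else [TApp.Aw i k, .q i 2 k]
    | .z j => [.litApp B j 0, .litApp B j 1, .litApp B j 2]

/-- The set of pairs `T_i`. -/
def Tset {n m : ℕ} (i : Fin n) : Finset (TApp n m × TSch n m) :=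
  {(.x i 0, .sT i), (.x i 1, .sT i), (.a i 5, .sF i)}

/-- The set of pairs `F_i`. -/
def Fset {n m : ℕ} (i : Fin n) : Finset (TApp n m × TSch n m) :=
  {(.y i 0, .sF i), (.y i 1, .sF i), (.a i 4, .sT i)}
namespace TAP

variable {A S P : Type*} [DecidableEq A] [DecidableEq S] [DecidableEq P]

/-- A total assignment `g` within the capacities has a stable graph as soon as every school `s`
that an applicant `a` prefers to `g a` has, in some subject of `a`, its single seat taken by an
applicant to whom `s` does not prefer `a`. -/
theorem stable_graph [Finite A] (J : TAP A S P) (g : A → S)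
    (hacc : ∀ a, g a ∈ J.prefA a) (hmem : ∀ a s, s ∈ J.prefA a → a ∈ J.prefS s)
    (hcap : ∀ s p, ((J.prefS s).filter fun a => g a = s ∧ p ∈ J.ptype a).length ≤ J.cap s p)
    (hblock : ∀ a s, J.PrefersA a s (g a) → ∃ p ∈ J.ptype a, J.cap s p = 1 ∧
      ∃ b, g b = s ∧ p ∈ J.ptype b ∧ ¬ J.PrefersS s a b) :
    ∃ M : Finset (A × S), J.Stable M := by
  classical
  have := Fintype.ofFinite A
  let M : Finset (A × S) := Finset.univ.image fun a => (a, g a)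
  have mem_M : ∀ a s, (a, s) ∈ M ↔ g a = s := by simp [M]
  have mem_Mp : ∀ s p b, b ∈ J.Mp M s p ↔ g b = s ∧ p ∈ J.ptype b := by
    intro s p b
    simp only [Mp, Finset.mem_image, Finset.mem_filter, Prod.exists, exists_and_right,
      exists_eq_right, mem_M]
    grind
  have card_Mp : ∀ s p, (J.Mp M s p).card ≤ J.cap s p := by
    intro s p
    refine le_trans (Finset.card_le_card ?_) ((List.toFinset_card_le _).trans (hcap s p))
    intro b hb
    rw [mem_Mp] at hb
    simpa using ⟨hmem b s (hb.1 ▸ hacc b), hb⟩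
  refine ⟨M, ⟨⟨?_, ?_⟩, card_Mp⟩, ?_⟩
  · rintro ⟨a, s⟩ h
    rw [mem_M] at h
    exact h ▸ hacc a
  · intro a s s' h h'
    rw [mem_M] at h h'
    exact h.symm.trans h'
  · rintro a s ⟨-, hpref, p₁, p₂, -, htype, h⟩
    have hp : J.PrefersA a s (g a) := by
      rcases hpref with hu | ⟨s', hs', h'⟩
      · exact absurd ((mem_M a (g a)).2 rfl) (hu _)
      · rw [mem_M] at hs'
        exact hs' ▸ h'
    obtain ⟨p, hpa, hcap1, b, hbs, hpb, hab⟩ := hblock a s hp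
    have hb : b ∈ J.Mp M s p := (mem_Mp s p b).2 ⟨hbs, hpb⟩
    have hle := hcap1 ▸ card_Mp s p
    have hfull : ¬ J.Undersub M s p := by
      have := Finset.card_pos.2 ⟨b, hb⟩
      unfold Undersub
      omega
    have hbest : ∀ c ∈ J.Mp M s p, ¬ J.PrefersS s a c := by
      intro c hc
      rwa [Finset.card_le_one.1 hle c hc b hb]
    have hMpr : ∀ c ∈ J.Mpr M s p₁ p₂, c ∈ J.Mp M s p := by
      intro c hc
      simp only [Mpr, Finset.mem_image, Finset.mem_filter, Prod.exists, exists_and_right,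
        exists_eq_right, mem_M] at hc
      rw [mem_Mp]
      obtain ⟨s', h1, h2, h3⟩ := hc
      exact ⟨h1.trans h2, by rw [h3, ← htype]; exact hpa⟩
    rw [htype, Finset.mem_insert, Finset.mem_singleton] at hpa
    rcases hpa with rfl | rfl <;> grind

end TAP

instance {n m : ℕ} : Finite (TApp n m) := by
  refine Finite.of_injective
    (β := (Fin n × Fin 6) ⊕ (Fin n × Fin 2) ⊕ (Fin n × Fin 2) ⊕ (Fin n × Fin 3 × Fin 4))
    (fun
      | .a i r => .inl (i, r)
      | .x i r => .inr (.inl (i, r))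
      | .y i r => .inr (.inr (.inl (i, r)))
      | .q i t k => .inr (.inr (.inr (i, t, k)))) ?_
  rintro (_ | _ | _ | _) (_ | _ | _ | _) h <;> simp_all

namespace E3SAT

variable {n m : ℕ}

/-- The assignment induced by a truth assignment `f`: the applicants of true literals get their
first choice, those of false literals are sent to the schools of their clauses. -/
def assign (B : E3SAT n m) (f : Fin n → Bool) : TApp n m → TSch n m
  | .a i r =>
      if f i then ![.s i 0, .s i 3, .s i 1, .s i 1, .s i 2, .sF i] r
      else ![.s i 2, .s i 1, .s i 0, .s i 0, .sT i, .s i 3] r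
  | .x i r => if f i then .sT i else .z (B.occurs i true r).1
  | .y i r => if f i then .z (B.occurs i false r).1 else .sF i
  | .q i t k => .w i (![1, 0, 2] t) k

theorem assign_mem_prefA (B : E3SAT n m) (f : Fin n → Bool) (a : TApp n m) :
    B.assign f a ∈ (tapOf B).prefA a := by
  rcases a with ⟨i, r⟩ | ⟨i, r⟩ | ⟨i, r⟩ | ⟨i, r, k⟩ <;> cases h : f i <;> fin_cases r <;>
    simp [assign, tapOf, h]

theorem litApp_occurs_true (B : E3SAT n m) (i : Fin n) (r : Fin 2) :
    TApp.litApp B (B.occurs i true r).1 (B.occurs i true r).2 = .x i r := by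
  simp [TApp.litApp, B.occInv_occurs]

theorem litApp_occurs_false (B : E3SAT n m) (i : Fin n) (r : Fin 2) :
    TApp.litApp B (B.occurs i false r).1 (B.occurs i false r).2 = .y i r := by
  simp [TApp.litApp, B.occInv_occurs]

theorem litApp_mem_prefS (B : E3SAT n m) (j : Fin m) (t : Fin 3) :
    TApp.litApp B j t ∈ (tapOf B).prefS (.z j) := by
  fin_cases t <;> simp [tapOf]

theorem mem_prefS (B : E3SAT n m) (a : TApp n m) (s : TSch n m)
    (h : s ∈ (tapOf B).prefA a) : a ∈ (tapOf B).prefS s := by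
  rcases a with ⟨i, r⟩ | ⟨i, r⟩ | ⟨i, r⟩ | ⟨i, r, k⟩
  · fin_cases r <;> simp [tapOf] at h <;> rcases h with rfl | rfl <;> simp [tapOf]
  · have hz := B.litApp_mem_prefS (B.occurs i true r).1 (B.occurs i true r).2
    rw [litApp_occurs_true] at hz
    simp only [tapOf, List.mem_cons, List.not_mem_nil, or_false] at h
    rcases h with rfl | rfl | rfl
    · fin_cases r <;> simp [tapOf]
    · exact hz
    · fin_cases r <;> simp [tapOf, TApp.Aw]
  · have hz := B.litApp_mem_prefS (B.occurs i false r).1 (B.occurs i false r).2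
    rw [litApp_occurs_false] at hz
    simp only [tapOf, List.mem_cons, List.not_mem_nil, or_false] at h
    rcases h with rfl | rfl | rfl
    · fin_cases r <;> simp [tapOf]
    · exact hz
    · fin_cases r <;> simp [tapOf, TApp.Aw]
  · fin_cases r <;> simp [tapOf] at h <;> rcases h with rfl | rfl <;> simp [tapOf]

/-- The applicant of a true literal is not assigned to the school of its clause. -/
theorem assign_litApp_ne (B : E3SAT n m) (f : Fin n → Bool) (j : Fin m) (t : Fin 3)
    (h : f (B.clause j t).1 = (B.clause j t).2) :
    B.assign f (TApp.litApp B j t) ≠ .z j := by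
  have hc := B.clause_occurs (B.occInv j t).1 (B.occInv j t).2.1 (B.occInv j t).2.2
  rw [B.occurs_occInv] at hc
  rw [hc] at h
  cases hb : (B.occInv j t).2.1 <;> simp_all [TApp.litApp, assign]

theorem assign_cap (B : E3SAT n m) (f : Fin n → Bool) (hf : B.Satisfies f) (s : TSch n m)
    (p : Subj) :
    (((tapOf B).prefS s).filter fun a => B.assign f a = s ∧ p ∈ (tapOf B).ptype a).length ≤
      (tapOf B).cap s p := by
  rcases s with ⟨i, r⟩ | i | i | ⟨i, t, k⟩ | j
  · fin_cases r <;> cases p <;> cases h : f i <;> simp [tapOf, assign, h]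
  · cases p <;> cases h : f i <;> simp [tapOf, assign, h]
  · cases p <;> cases h : f i <;> simp [tapOf, assign, h]
  · fin_cases t <;> fin_cases k <;> cases p <;> cases h : f i <;>
      simp [tapOf, assign, h, TApp.Aw]
  · obtain ⟨t, ht⟩ := hf j
    have hne := B.assign_litApp_ne f j t ht
    refine Nat.le_of_lt_succ (List.length_filter_lt_length_iff_exists.2
      ⟨_, B.litApp_mem_prefS j t, ?_⟩)
    simp [hne]

theorem assign_not_blocks (B : E3SAT n m) (f : Fin n → Bool) (a : TApp n m) (s : TSch n m)
    (h : (tapOf B).PrefersA a s (B.assign f a)) :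
    ∃ p ∈ (tapOf B).ptype a, (tapOf B).cap s p = 1 ∧
      ∃ b, B.assign f b = s ∧ p ∈ (tapOf B).ptype b ∧ ¬ (tapOf B).PrefersS s a b := by
  rcases a with ⟨i, r⟩ | ⟨i, r⟩ | ⟨i, r⟩ | ⟨i, r, k⟩
  · cases hi : f i <;> fin_cases r <;>
      simp [TAP.PrefersA, tapOf, assign, hi] at h <;> rcases h with ⟨rfl | rfl, h⟩ <;>
      simp at h
    · exact ⟨.I, by simp [tapOf], by simp [tapOf], .a i 3, by simp [assign, hi],
        by simp [tapOf], by simp [TAP.PrefersS, tapOf]⟩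
    · exact ⟨.I, by simp [tapOf], by simp [tapOf], .a i 1, by simp [assign, hi],
        by simp [tapOf], by simp [TAP.PrefersS, tapOf]⟩
    · exact ⟨.F, by simp [tapOf], by simp [tapOf], .a i 0, by simp [assign, hi],
        by simp [tapOf], by simp [TAP.PrefersS, tapOf]⟩
    · exact ⟨.F, by simp [tapOf], by simp [tapOf], .a i 2, by simp [assign, hi],
        by simp [tapOf], by simp [TAP.PrefersS, tapOf]⟩
    · exact ⟨.F, by simp [tapOf], by simp [tapOf], .a i 0, by simp [assign, hi],
        by simp [tapOf], by simp [TAP.PrefersS, tapOf]⟩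
    · exact ⟨.F, by simp [tapOf], by simp [tapOf], .a i 1, by simp [assign, hi],
        by simp [tapOf], by simp [TAP.PrefersS, tapOf]⟩
  · cases hi : f i <;> simp [TAP.PrefersA, tapOf, assign, hi] at h
    obtain ⟨rfl | rfl | rfl, h⟩ := h <;> simp at h
    refine ⟨if r = 0 then .F else .I, ?_, ?_, .a i 4, ?_, ?_, ?_⟩ <;> fin_cases r <;>
      simp [TAP.PrefersS, tapOf, assign, hi]
  · cases hi : f i <;> simp [TAP.PrefersA, tapOf, assign, hi] at h
    obtain ⟨rfl | rfl | rfl, h⟩ := h <;> simp at h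
    refine ⟨if r = 0 then .F else .I, ?_, ?_, .a i 5, ?_, ?_, ?_⟩ <;> fin_cases r <;>
      simp [TAP.PrefersS, tapOf, assign, hi]
  · fin_cases r <;> simp [TAP.PrefersA, tapOf, assign] at h

end E3SAT

theorem stmt6 {n m : ℕ} (B : E3SAT n m) (f : Fin n → Bool) (hf : B.Satisfies f) :
    ∃ M : Finset (TApp n m × TSch n m), (tapOf B).Stable M := by
  exact (tapOf B).stable_graph (B.assign f) (B.assign_mem_prefA f) B.mem_prefS
    (B.assign_cap f hf) (B.assign_not_blocks f)
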